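/- Let λ > 0, let 0 < ε < 1, and suppose T > 8ε²/λ, so that Δ := ε·√(2λ/T) satisfies Δ < λ/2. Then the Kullback–Leibler divergence between the Poisson distribution with mean (λ − Δ)T and the Poisson distribution with mean λT satisfies D(P_{(λ−Δ)T} ‖ P_{λT}) ≤ 2ε². -/

import Mathlib

/-- The Poisson probability mass function with mean `m`: `P(n) = e^{-m} mⁿ / n!`. -/
noncomputable def poissonPMF (m : ℝ) (n : ℕ) : ℝ :=
  Real.exp (-m) * m ^ n / n.factorial

/-- Kullback–Leibler divergence between two pmfs on ℕ:
`D(P ‖ Q) = ∑ₙ P(n) log(P(n)/Q(n))`. -/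
noncomputable def klDivPMF (P Q : ℕ → ℝ) : ℝ :=
  ∑' n : ℕ, P n * Real.log (P n / Q n)

theorem poissonPMF_succ (m : ℝ) (n : ℕ) :
    ((n + 1 : ℕ) : ℝ) * poissonPMF m (n + 1) = m * poissonPMF m n := by
  have h : (n.factorial : ℝ) ≠ 0 := by positivity
  have h' : (n : ℝ) + 1 ≠ 0 := by positivity
  unfold poissonPMF
  rw [Nat.factorial_succ]
  push_cast
  field_simp
  ring

theorem hasSum_poissonPMF (m : ℝ) : HasSum (poissonPMF m) 1 := by
  have h := (NormedSpace.expSeries_div_hasSum_exp (𝔸 := ℝ) m).mul_left (Real.exp (-m))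
  rw [← Real.exp_eq_exp_ℝ, ← Real.exp_add, neg_add_cancel, Real.exp_zero] at h
  simp only [← mul_div_assoc] at h
  exact h

theorem hasSum_mean_poissonPMF (m : ℝ) :
    HasSum (fun n : ℕ => (n : ℝ) * poissonPMF m n) m := by
  rw [← hasSum_nat_add_iff' 1]
  simpa only [poissonPMF_succ, mul_one, Finset.sum_range_one, Nat.cast_zero, zero_mul,
    sub_zero] using (hasSum_poissonPMF m).mul_left m

theorem log_poissonPMF_div {a b : ℝ} (ha : 0 < a) (hb : 0 < b) (n : ℕ) :
    Real.log (poissonPMF a n / poissonPMF b n) = (b - a) + n * Real.log (a / b) := by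
  have h : poissonPMF a n / poissonPMF b n = Real.exp (b - a) * (a / b) ^ n := by
    have hf : (n.factorial : ℝ) ≠ 0 := by positivity
    rw [show b - a = -a - -b by ring, Real.exp_sub, div_pow]
    unfold poissonPMF
    field_simp
  rw [h, Real.log_mul (Real.exp_ne_zero _) (by positivity), Real.log_exp, Real.log_pow]

theorem klDivPMF_poissonPMF {a b : ℝ} (ha : 0 < a) (hb : 0 < b) :
    klDivPMF (poissonPMF a) (poissonPMF b) = b - a + a * Real.log (a / b) := by
  have h := ((hasSum_poissonPMF a).mul_left (b - a)).add
    ((hasSum_mean_poissonPMF a).mul_right (Real.log (a / b)))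
  rw [mul_one] at h
  rw [← h.tsum_eq, klDivPMF]
  refine tsum_congr fun n => ?_
  rw [log_poissonPMF_div ha hb]
  ring

theorem klDivPMF_poissonPMF_le {a b : ℝ} (ha : 0 < a) (hb : 0 < b) :
    klDivPMF (poissonPMF a) (poissonPMF b) ≤ (b - a) ^ 2 / b := by
  rw [klDivPMF_poissonPMF ha hb]
  calc b - a + a * Real.log (a / b)
      ≤ b - a + a * (a / b - 1) := by
        gcongr
        exact Real.log_le_sub_one_of_pos (by positivity)
    _ = (b - a) ^ 2 / b := by
        field_simp
        ring

/-- For `λ > 0`, `0 < ε < 1` and `T > 8ε²/λ`, the quantity `Δ := ε √(2λ/T)`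
satisfies `Δ < λ/2`, and `D(P_{(λ−Δ)T} ‖ P_{λT}) ≤ 2ε²`. -/
theorem klDiv_poisson_slowdown_covert (lam ε T Δ : ℝ) (hlam : 0 < lam)
    (hε0 : 0 < ε) (hε1 : ε < 1) (hT : T > 8 * ε ^ 2 / lam)
    (hΔ : Δ = ε * Real.sqrt (2 * lam / T)) :
    Δ < lam / 2 ∧
    klDivPMF (poissonPMF ((lam - Δ) * T)) (poissonPMF (lam * T)) ≤ 2 * ε ^ 2 := by
  have hT0 : 0 < T := lt_trans (by positivity) hT
  have hsq : Δ ^ 2 * T = 2 * lam * ε ^ 2 := by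
    rw [hΔ, mul_pow, Real.sq_sqrt (by positivity)]
    field_simp
  have hlt : Δ < lam / 2 := by
    have h8 : 8 * ε ^ 2 < T * lam := (div_lt_iff₀ hlam).1 hT
    refine lt_of_pow_lt_pow_left₀ 2 (by positivity) (lt_of_mul_lt_mul_right ?_ hT0.le)
    rw [hsq]
    nlinarith
  refine ⟨hlt, ?_⟩
  refine (klDivPMF_poissonPMF_le (mul_pos (by linarith) hT0) (mul_pos hlam hT0)).trans_eq ?_
  rw [div_eq_iff (by positivity)]
  linear_combination T * hsq
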